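/- Let α = (α_n)_{n≥0} be a monotone decreasing sequence of positive real numbers with nondecreasing successive differences (α_n − 2α_{n+1} + α_{n+2} ≥ 0 for all n), and suppose ∑_{n≥0} α_n/(n+1) < ∞. Then ∑_{n≥0} (α_n − 2α_{n+1} + α_{n+2})(n+1) log(n+2) ≤ 4 ∑_{n≥0} α_n/(n+1). -/

import Mathlib

noncomputable def WW (x : ℝ) : ℝ := x * Real.log (x + 1)

theorem WW_c (n : ℕ) : WW ((n:ℝ) + 1) - 2 * WW n + WW ((n:ℝ) - 1) ≤ 4 / ((n:ℝ) + 1) := by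
  unfold WW
  rcases Nat.eq_zero_or_pos n with rfl | hn
  · have := Real.log_le_sub_one_of_pos (show (0:ℝ) < 2 by norm_num)
    norm_num
    linarith
  · have hn1 : (1:ℝ) ≤ n := by exact_mod_cast hn
    have h0 : (0:ℝ) < n := by linarith
    have h1 : (0:ℝ) < (n:ℝ) + 1 := by linarith
    have h2 : (0:ℝ) < (n:ℝ) + 2 := by linarith
    have a := Real.log_le_sub_one_of_pos (div_pos h2 h1)
    have b := Real.log_le_sub_one_of_pos (div_pos h0 h1)
    rw [Real.log_div h2.ne' h1.ne'] at a
    rw [Real.log_div h0.ne' h1.ne'] at b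
    have a' := mul_le_mul_of_nonneg_left a h1.le
    have b' := mul_le_mul_of_nonneg_left b (sub_nonneg.2 hn1)
    have e : ((n:ℝ)+1) * (((n:ℝ)+2)/((n:ℝ)+1) - 1) + ((n:ℝ)-1) * ((n:ℝ)/((n:ℝ)+1) - 1)
        = 2 / ((n:ℝ)+1) := by
      field_simp
      ring
    have f : 2 / ((n:ℝ)+1) ≤ 4 / ((n:ℝ)+1) := by gcongr; norm_num
    have g1 : (n:ℝ) + 1 + 1 = n + 2 := by ring
    have g2 : (n:ℝ) - 1 + 1 = n := by ring
    rw [g1, g2]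
    linarith

theorem WW_nonneg (n : ℕ) : 0 ≤ WW n := by
  unfold WW
  exact mul_nonneg (Nat.cast_nonneg n) (Real.log_nonneg (by linarith [Nat.cast_nonneg (α := ℝ) n]))

theorem WW_mono (n : ℕ) : 0 ≤ WW n - WW ((n:ℝ) - 1) := by
  unfold WW
  rcases Nat.eq_zero_or_pos n with rfl | hn
  · norm_num
  · have hn1 : (1:ℝ) ≤ n := by exact_mod_cast hn
    have g2 : (n:ℝ) - 1 + 1 = n := by ring
    rw [g2, sub_nonneg]
    have h1 : Real.log n ≤ Real.log ((n:ℝ)+1) := Real.log_le_log (by linarith) (by linarith)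
    exact mul_le_mul (by linarith) h1 (Real.log_nonneg hn1) (by linarith)

theorem WW_abel (α : ℕ → ℝ) (N : ℕ) :
    ∑ n ∈ Finset.range N, (α n - 2 * α (n + 1) + α (n + 2)) * WW ((n:ℝ) + 1)
      + (α N - α (N+1)) * WW N + α N * (WW N - WW ((N:ℝ) - 1))
    = ∑ n ∈ Finset.range N, α n * (WW ((n:ℝ) + 1) - 2 * WW n + WW ((n:ℝ) - 1)) := by
  induction N with
  | zero => simp [WW]
  | succ N ih =>
    rw [Finset.sum_range_succ, Finset.sum_range_succ, ← ih]
    push_cast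
    rw [add_sub_cancel_right]
    ring

/-- If `α` is a monotone decreasing, concave sequence of positive numbers with
`∑ α_n/(n+1) < ∞`, then `∑ (α_n - 2α_{n+1} + α_{n+2})(n+1) log(n+2) ≤ 4 ∑ α_n/(n+1)`. -/
theorem second_difference_sum_bound (α : ℕ → ℝ)
    (hpos : ∀ n, 0 < α n)
    (hdec : ∀ n, α (n + 1) ≤ α n)
    (hconc : ∀ n, 0 ≤ α n - 2 * α (n + 1) + α (n + 2))
    (hsum : Summable fun n => α n / ((n : ℝ) + 1)) :
    ∑' n : ℕ, ENNReal.ofReal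
        ((α n - 2 * α (n + 1) + α (n + 2)) * ((n : ℝ) + 1) * Real.log ((n : ℝ) + 2)) ≤
      ENNReal.ofReal (4 * ∑' n : ℕ, α n / ((n : ℝ) + 1)) := by
  have hW : ∀ n : ℕ, (α n - 2 * α (n + 1) + α (n + 2)) * ((n : ℝ) + 1) * Real.log ((n : ℝ) + 2)
      = (α n - 2 * α (n + 1) + α (n + 2)) * WW ((n:ℝ) + 1) := by
    intro n
    unfold WW
    rw [show (n:ℝ) + 1 + 1 = n + 2 by ring, mul_assoc]
  have hWn : ∀ n : ℕ, 0 ≤ (α n - 2 * α (n + 1) + α (n + 2)) * WW ((n:ℝ) + 1) := by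
    intro n
    have := WW_nonneg (n + 1)
    push_cast at this
    exact mul_nonneg (hconc n) this
  simp_rw [hW]
  rw [ENNReal.tsum_eq_iSup_nat]
  refine iSup_le fun N => ?_
  rw [← ENNReal.ofReal_sum_of_nonneg fun n _ => hWn n]
  apply ENNReal.ofReal_le_ofReal
  have h1 := WW_abel α N
  have h2 := mul_nonneg (sub_nonneg.2 (hdec N)) (WW_nonneg N)
  have h3 := mul_nonneg (hpos N).le (WW_mono N)
  have h4 : ∑ n ∈ Finset.range N, α n * (WW ((n:ℝ) + 1) - 2 * WW n + WW ((n:ℝ) - 1))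
      ≤ 4 * ∑ n ∈ Finset.range N, α n / ((n:ℝ) + 1) := by
    rw [Finset.mul_sum]
    refine Finset.sum_le_sum fun n _ => ?_
    refine (mul_le_mul_of_nonneg_left (WW_c n) (hpos n).le).trans (le_of_eq ?_)
    ring
  have h5 := hsum.sum_le_tsum (Finset.range N)
    (fun n _ => div_nonneg (hpos n).le (by positivity))
  linarith
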